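/- arXiv:1702.06814 — 2 statements merged into one kernel-verified Lean document; each statement's English description precedes it below -/
import Mathlib

section
/- There exist a constant c > 0 and a real x₀ such that for all x ≥ x₀, ∑_{p prime, x ≤ p ≤ 2x} (1/(4√p)) ∑_{n ∈ ℕ, p − 2√p ≤ n ≤ p + 2√p} (Λ(n)/log n) · (φ(n)/n) ≥ c · x/(log x)². -/
open Finset ArithmeticFunction

/-- The factors of the central binomial coefficient, bounded through the number of primes in
`(n, 2n]`. -/
theorem centralBinom_le_pow_card_primes (n : ℕ) (hn : 2 < n) :
    n.centralBinom ≤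
      (2 * n) ^ (#{p ∈ Ioc n (2 * n) | p.Prime} + Nat.sqrt (2 * n)) * 4 ^ (2 * n / 3) := by
  set S := {p ∈ range (2 * n + 1) | p.Prime} with hS
  have hprod : ∏ p ∈ S, p ^ n.centralBinom.factorization p = n.centralBinom := by
    conv_rhs => rw [← n.prod_pow_factorization_centralBinom]
    refine prod_filter_of_ne fun p _ h => ?_
    contrapose h
    rw [Nat.factorization_eq_zero_of_not_prime n.centralBinom h, pow_zero]
  have hle : ∏ p ∈ S, p ^ n.centralBinom.factorization p ≤
      ∏ p ∈ S, (if p ≤ Nat.sqrt (2 * n) ∨ n < p then 2 * n else 1) *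
        (if p ≤ 2 * n / 3 then p else 1) := by
    refine prod_le_prod' fun p hp => ?_
    have hpp : p.Prime := (mem_filter.1 hp).2
    have hfac : (if p ≤ 2 * n / 3 then p else 1) ≥ 1 := by
      split_ifs
      exacts [hpp.one_lt.le, le_rfl]
    by_cases h1 : p ≤ Nat.sqrt (2 * n) ∨ n < p
    · rw [if_pos h1]
      calc p ^ n.centralBinom.factorization p ≤ 2 * n * 1 := by
            rw [mul_one]
            exact Nat.pow_factorization_choose_le (by lia)
        _ ≤ _ := Nat.mul_le_mul_left _ hfac
    · rw [if_neg h1, one_mul]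
      push Not at h1
      split_ifs with h2
      · refine (pow_right_mono₀ hpp.one_lt.le ?_).trans (pow_one p).le
        exact Nat.factorization_choose_le_one (Nat.sqrt_lt'.mp h1.1)
      · rw [Nat.factorization_centralBinom_of_two_mul_self_lt_three_mul hn h1.2 (by lia),
          pow_zero]
  rw [hprod, prod_mul_distrib] at hle
  refine hle.trans (Nat.mul_le_mul ?_ ?_)
  · rw [← prod_filter, prod_const]
    refine pow_right_mono₀ (by lia) ?_
    calc #{p ∈ S | p ≤ Nat.sqrt (2 * n) ∨ n < p}
        ≤ #({p ∈ Ioc n (2 * n) | p.Prime} ∪ Icc 1 (Nat.sqrt (2 * n))) := by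
          refine card_le_card fun p hp => ?_
          simp only [hS, mem_filter, mem_range, mem_union, mem_Ioc, mem_Icc] at hp ⊢
          have := hp.1.2.one_lt
          rcases hp.2 with h | h
          · exact Or.inr ⟨this.le, h⟩
          · exact Or.inl ⟨⟨h, by lia⟩, hp.1.2⟩
      _ ≤ _ := (card_union_le _ _).trans (by simp)
  · rw [← prod_filter]
    refine le_trans ?_ (primorial_le_four_pow (2 * n / 3))
    refine prod_le_prod_of_subset_of_one_le' (fun p hp => ?_) fun p hp _ =>
      (mem_filter.1 hp).2.one_lt.le
    simp only [hS, mem_filter, mem_range] at hp ⊢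
    exact ⟨by lia, hp.1.2⟩

/-- A quantitative form of Bertrand's postulate. -/
theorem eventually_le_card_primes_mul_log :
    ∀ᶠ n : ℕ in Filter.atTop,
      (n : ℝ) / 3 ≤ #{p ∈ Ioc n (2 * n) | p.Prime} * Real.log (2 * n) := by
  have hlim : ∀ᶠ y : ℝ in Filter.atTop, (Real.sqrt y + 1) * Real.log y ≤ (1 / 24) * y := by
    have h := (isLittleO_log_rpow_atTop (r := 1 / 2) (by norm_num)).bound
      (c := 1 / 48) (by norm_num)
    filter_upwards [h, Filter.eventually_ge_atTop 1] with y hy h1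
    rw [← Real.sqrt_eq_rpow, Real.norm_of_nonneg (Real.log_nonneg h1),
      Real.norm_of_nonneg (Real.sqrt_nonneg _)] at hy
    have hs : 1 ≤ Real.sqrt y := Real.one_le_sqrt.2 h1
    nlinarith [Real.sq_sqrt (zero_le_one.trans h1)]
  have hcast : Filter.Tendsto (fun n : ℕ => 2 * (n : ℝ)) Filter.atTop Filter.atTop :=
    tendsto_natCast_atTop_atTop.const_mul_atTop (by norm_num)
  filter_upwards [hcast.eventually hlim, Filter.eventually_ge_atTop 4] with n hlog hn
  set N := #{p ∈ Ioc n (2 * n) | p.Prime}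
  have hn' : (4 : ℝ) ≤ n := by exact_mod_cast hn
  have hpow : 4 ^ n ≤ (2 * n) ^ (N + Nat.sqrt (2 * n) + 1) * 4 ^ (2 * n / 3) := by
    calc 4 ^ n ≤ n * n.centralBinom := (Nat.four_pow_lt_mul_centralBinom n hn).le
      _ ≤ (2 * n) * ((2 * n) ^ (N + Nat.sqrt (2 * n)) * 4 ^ (2 * n / 3)) :=
          Nat.mul_le_mul (by lia) (centralBinom_le_pow_card_primes n (by lia))
      _ = _ := by ring
  have hpow' : (4 : ℝ) ^ n ≤
      (2 * n) ^ (N + Nat.sqrt (2 * n) + 1) * 4 ^ (2 * n / 3) := by exact_mod_cast hpow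
  have hl := Real.log_le_log (by positivity) hpow'
  rw [Real.log_mul (by positivity) (by positivity), Real.log_pow, Real.log_pow,
    Real.log_pow] at hl
  push_cast at hl
  have hlog4 : 1.38 ≤ Real.log 4 := by
    rw [show (4 : ℝ) = 2 ^ 2 by norm_num, Real.log_pow]
    have := Real.log_two_gt_d9
    norm_num at this ⊢
    linarith
  have hdiv : ((2 * n / 3 : ℕ) : ℝ) ≤ 2 * n / 3 := by
    exact_mod_cast Nat.cast_div_le (α := ℝ) (m := 2 * n) (n := 3)
  have hsqrt : ((Nat.sqrt (2 * n) : ℕ) : ℝ) ≤ Real.sqrt (2 * n) := by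
    exact_mod_cast Real.nat_sqrt_le_real_sqrt (a := 2 * n)
  have hL : 0 ≤ Real.log (2 * n) := Real.log_nonneg (by linarith)
  nlinarith [mul_le_mul_of_nonneg_right hsqrt hL,
    mul_le_mul_of_nonneg_right hdiv (by linarith : 0 ≤ Real.log 4)]

/-- By Cauchy–Schwarz, a map from `s` into a set of size `#t` has many collisions. -/
theorem card_sq_le_card_mul_sum_card_fiber {α β : Type*} [DecidableEq β]
    {s : Finset α} {t : Finset β} {f : α → β} (h : Set.MapsTo f s t) :
    #s ^ 2 ≤ #t * ∑ a ∈ s, #{b ∈ s | f b = f a} := by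
  have hsum : ∑ a ∈ s, #{b ∈ s | f b = f a} = ∑ y ∈ t, #{b ∈ s | f b = y} ^ 2 := by
    rw [← sum_fiberwise_of_maps_to h]
    refine sum_congr rfl fun y _ => ?_
    rw [sq, ← smul_eq_mul, ← sum_const]
    exact sum_congr rfl fun a ha => by rw [(mem_filter.1 ha).2]
  rw [hsum, card_eq_sum_card_fiberwise h]
  have := sq_sum_le_card_mul_sum_sq (s := t) (f := fun y => (#{b ∈ s | f b = y} : ℝ))
  exact_mod_cast this

/-- The weight `Λ(n) φ(n) / (n log n)` is nonnegative. -/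
theorem vonMangoldt_div_log_mul_totient_nonneg (n : ℕ) :
    0 ≤ (Λ n / Real.log n) * ((Nat.totient n : ℝ) / n) := by
  have h1 := vonMangoldt_nonneg (n := n)
  have h2 := Real.log_natCast_nonneg n
  positivity

/-- The weight `Λ(q) φ(q) / (q log q)` is at least `1 / 2` at primes. -/
theorem half_le_vonMangoldt_div_log_mul_totient {q : ℕ} (hq : q.Prime) :
    1 / 2 ≤ (Λ q / Real.log q) * ((Nat.totient q : ℝ) / q) := by
  have h2 : (2 : ℝ) ≤ q := by exact_mod_cast hq.two_le
  have hlog : 0 < Real.log q := Real.log_pos (by linarith)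
  rw [vonMangoldt_apply_prime hq, div_self hlog.ne', one_mul, Nat.totient_prime hq,
    Nat.cast_sub hq.one_lt.le, Nat.cast_one, div_le_div_iff₀ (by norm_num) (by linarith)]
  linarith

/-- The contribution of a prime `p ∈ (n, 2n]` is bounded below by the number of primes lying in
the same block of length `⌊√n⌋` as `p`. -/
theorem card_primes_same_block_le {n p : ℕ} (hn : 0 < n) (hp1 : n < p) (hp2 : p ≤ 2 * n) :
    (1 / (16 * Real.sqrt n)) *
        (#{q ∈ {q ∈ Ioc n (2 * n) | q.Prime} | q / Nat.sqrt n = p / Nat.sqrt n} : ℝ) ≤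
      (1 / (4 * Real.sqrt p)) *
        ∑ k ∈ Icc ⌈(p : ℝ) - 2 * Real.sqrt p⌉₊ ⌊(p : ℝ) + 2 * Real.sqrt p⌋₊,
          (Λ k / Real.log k) * (Nat.totient k / k) := by
  set P := {q ∈ Ioc n (2 * n) | q.Prime}
  set m := Nat.sqrt n
  have hm : 0 < m := Nat.sqrt_pos.2 hn
  have hms : (m : ℝ) ≤ Real.sqrt n := Real.nat_sqrt_le_real_sqrt
  have hnR : (0 : ℝ) < n := by exact_mod_cast hn
  have hs0 : 0 < Real.sqrt n := Real.sqrt_pos.2 hnR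
  have hsq : Real.sqrt n ^ 2 = n := Real.sq_sqrt hnR.le
  have hpn : (n : ℝ) ≤ p := by exact_mod_cast hp1.le
  have hpn2 : (p : ℝ) ≤ 2 * n := by exact_mod_cast hp2
  have hsp : Real.sqrt n ≤ Real.sqrt p := Real.sqrt_le_sqrt hpn
  have hsp0 : 0 < Real.sqrt p := hs0.trans_le hsp
  have hsp2 : Real.sqrt p ≤ 2 * Real.sqrt n := by
    rw [Real.sqrt_le_left (by linarith)]
    nlinarith
  have hsub : {q ∈ P | q / m = p / m} ⊆
      Icc ⌈(p : ℝ) - 2 * Real.sqrt p⌉₊ ⌊(p : ℝ) + 2 * Real.sqrt p⌋₊ := by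
    intro q hq
    have hqm : q / m = p / m := (mem_filter.1 hq).2
    have h1 := Nat.div_add_mod q m
    have h2 := Nat.div_add_mod p m
    have h3 := Nat.mod_lt q hm
    have h4 := Nat.mod_lt p hm
    rw [hqm] at h1
    have h5 : (q : ℝ) ≤ p + m := by exact_mod_cast (by lia : q ≤ p + m)
    have h6 : (p : ℝ) ≤ q + m := by exact_mod_cast (by lia : p ≤ q + m)
    rw [mem_Icc, Nat.ceil_le]
    exact ⟨by linarith, Nat.le_floor (by linarith)⟩
  have hinner : (1 / 2) * (#{q ∈ P | q / m = p / m} : ℝ) ≤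
      ∑ k ∈ Icc ⌈(p : ℝ) - 2 * Real.sqrt p⌉₊ ⌊(p : ℝ) + 2 * Real.sqrt p⌋₊,
        (Λ k / Real.log k) * (Nat.totient k / k) := by
    calc (1 / 2) * (#{q ∈ P | q / m = p / m} : ℝ)
        = ∑ q ∈ P with q / m = p / m, (1 / 2 : ℝ) := by
          rw [sum_const, nsmul_eq_mul, mul_comm]
      _ ≤ ∑ q ∈ P with q / m = p / m, (Λ q / Real.log q) * ((Nat.totient q : ℝ) / q) :=
          sum_le_sum fun q hq => half_le_vonMangoldt_div_log_mul_totient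
            (mem_filter.1 (mem_filter.1 hq).1).2
      _ ≤ _ := sum_le_sum_of_subset_of_nonneg hsub fun k _ _ =>
          vonMangoldt_div_log_mul_totient_nonneg k
  have hweight : 1 / (4 * (2 * Real.sqrt n)) ≤ 1 / (4 * Real.sqrt p) :=
    one_div_le_one_div_of_le (by linarith) (by linarith)
  calc (1 / (16 * Real.sqrt n)) * (#{q ∈ P | q / m = p / m} : ℝ)
      = (1 / (4 * (2 * Real.sqrt n))) * ((1 / 2) * (#{q ∈ P | q / m = p / m} : ℝ)) := by
        ring
    _ ≤ _ := mul_le_mul hweight hinner (by positivity) (by positivity)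

/-- The average over primes in `(n, 2n]` is at least a constant times the square of the number of
such primes divided by `n`. -/
theorem card_primes_sq_div_le_sum (n : ℕ) (hn : 0 < n) :
    (#{p ∈ Ioc n (2 * n) | p.Prime} : ℝ) ^ 2 / (80 * n) ≤
      ∑ p ∈ Ioc n (2 * n) with p.Prime, (1 / (4 * Real.sqrt p)) *
        ∑ k ∈ Icc ⌈(p : ℝ) - 2 * Real.sqrt p⌉₊ ⌊(p : ℝ) + 2 * Real.sqrt p⌋₊,
          (Λ k / Real.log k) * (Nat.totient k / k) := by
  refine le_trans ?_ (sum_le_sum fun p hp => card_primes_same_block_le hn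
    (mem_Ioc.1 (mem_filter.1 hp).1).1 (mem_Ioc.1 (mem_filter.1 hp).1).2)
  set P := {p ∈ Ioc n (2 * n) | p.Prime}
  set m := Nat.sqrt n
  have hm : 0 < m := Nat.sqrt_pos.2 hn
  have hnR : (1 : ℝ) ≤ n := by exact_mod_cast hn
  have hs1 : 1 ≤ Real.sqrt n := Real.one_le_sqrt.2 hnR
  have hsq : Real.sqrt n ^ 2 = n := Real.sq_sqrt (by linarith)
  have hms : Real.sqrt n ≤ 2 * m := by
    have h1 : Real.sqrt n ≤ m + 1 := Real.real_sqrt_le_nat_sqrt_succ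
    have h2 : (1 : ℝ) ≤ m := by exact_mod_cast hm
    linarith
  have hcs : #P ^ 2 ≤ #(range (2 * n / m + 1)) * ∑ p ∈ P, #{q ∈ P | q / m = p / m} := by
    refine card_sq_le_card_mul_sum_card_fiber (f := fun p => p / m) fun p hp => ?_
    have := (mem_Ioc.1 (mem_filter.1 hp).1).2
    simpa [Nat.lt_succ_iff] using Nat.div_le_div_right this
  have hcsR : (#P : ℝ) ^ 2 ≤
      ((2 * n / m : ℕ) + 1) * ∑ p ∈ P, (#{q ∈ P | q / m = p / m} : ℝ) := by
    rw [card_range] at hcs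
    exact_mod_cast hcs
  have hblocks : (((2 * n / m : ℕ) : ℝ) + 1) ≤ 5 * Real.sqrt n := by
    have h1 : ((2 * n / m : ℕ) : ℝ) ≤ 2 * n / m := by
      exact_mod_cast Nat.cast_div_le (α := ℝ) (m := 2 * n) (n := m)
    have h2 : 2 * (n : ℝ) / m ≤ 4 * Real.sqrt n := by
      rw [div_le_iff₀ (by exact_mod_cast hm)]
      nlinarith
    linarith
  have hT : 0 ≤ ∑ p ∈ P, (#{q ∈ P | q / m = p / m} : ℝ) :=
    sum_nonneg fun _ _ => Nat.cast_nonneg _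
  rw [← mul_sum, div_le_iff₀ (by linarith)]
  refine (hcsR.trans (mul_le_mul_of_nonneg_right hblocks hT)).trans_eq ?_
  generalize ∑ p ∈ P, (#{q ∈ P | q / m = p / m} : ℝ) = T
  rw [div_mul_eq_mul_div, div_mul_eq_mul_div, eq_div_iff (by linarith)]
  linear_combination 80 * T * hsq

/-- **Lower bound for the main term.** There exist a constant `c > 0` and a real `x₀` such
that for all `x ≥ x₀`,
`∑_{p prime, x ≤ p ≤ 2x} (1/(4√p)) ∑_{n ∈ ℕ, p − 2√p ≤ n ≤ p + 2√p} (Λ(n)/log n) · (φ(n)/n)`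
is at least `c · x/(log x)²`. -/
theorem main_term_lower_bound :
    ∃ c : ℝ, 0 < c ∧ ∃ x₀ : ℝ, ∀ x : ℝ, x₀ ≤ x →
      c * (x / Real.log x ^ 2) ≤
        ∑ p ∈ (Finset.Icc ⌈x⌉₊ ⌊2 * x⌋₊).filter Nat.Prime,
          (1 / (4 * Real.sqrt p)) *
            ∑ n ∈ Finset.Icc ⌈(p : ℝ) - 2 * Real.sqrt p⌉₊ ⌊(p : ℝ) + 2 * Real.sqrt p⌋₊,
              (Λ n / Real.log n) * (Nat.totient n / n) := by
  refine ⟨1 / (144 * 80), by norm_num, ?_⟩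
  apply Filter.eventually_atTop.1
  filter_upwards [tendsto_nat_floor_atTop.eventually eventually_le_card_primes_mul_log,
    Filter.eventually_ge_atTop 2] with x hN hx
  set n := ⌊x⌋₊
  have hn : 0 < n := Nat.floor_pos.2 (by linarith)
  have hnx : (n : ℝ) ≤ x := Nat.floor_le (by linarith)
  have hxn : x < n + 1 := Nat.lt_floor_add_one x
  have hlogx : 0 < Real.log x := Real.log_pos (by linarith)
  have hlog2 : Real.log (2 * n) ≤ 2 * Real.log x := by
    rw [two_mul (Real.log x), ← Real.log_mul (by linarith) (by linarith)]
    exact Real.log_le_log (by positivity) (by gcongr)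
  calc 1 / (144 * 80) * (x / Real.log x ^ 2)
      ≤ (#{p ∈ Ioc n (2 * n) | p.Prime} : ℝ) ^ 2 / (80 * n) := by
        set N : ℝ := (#{p ∈ Ioc n (2 * n) | p.Prime} : ℝ)
        have hN0 : 0 ≤ N := Nat.cast_nonneg _
        have hN1 : x / 12 / Real.log x ≤ N := by
          rw [div_le_iff₀ hlogx]
          nlinarith [mul_le_mul_of_nonneg_left hlog2 hN0]
        calc 1 / (144 * 80) * (x / Real.log x ^ 2) = (x / 12 / Real.log x) ^ 2 / (80 * x) := by
              field_simp
              norm_num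
          _ ≤ _ := by gcongr
    _ ≤ _ := card_primes_sq_div_le_sum n hn
    _ ≤ _ := by
        refine sum_le_sum_of_subset_of_nonneg (fun p hp => ?_) fun p _ _ =>
          mul_nonneg (by positivity) (sum_nonneg fun k _ =>
            vonMangoldt_div_log_mul_totient_nonneg k)
        simp only [mem_filter, mem_Ioc, mem_Icc] at hp ⊢
        have h1 : (n : ℝ) + 1 ≤ p := by exact_mod_cast hp.1.1
        have h2 : (p : ℝ) ≤ 2 * n := by exact_mod_cast hp.1.2
        exact ⟨⟨Nat.ceil_le.2 (by linarith), Nat.le_floor (by linarith)⟩, hp.2⟩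
end

section
/- For every prime p ≥ 3, one has ∑_{n ≤ p + 2√p} Λ(n)/n ≤ 2 log p, where the sum ranges over all natural numbers n with 1 ≤ n ≤ p + 2√p. -/
open Finset ArithmeticFunction

/-- The bound `n! ≤ ((n + 1) / 2) ^ n`, with denominators cleared. -/
theorem factorial_mul_two_pow_le_succ_pow (n : ℕ) : n.factorial * 2 ^ n ≤ (n + 1) ^ n := by
  induction n with
  | zero => simp
  | succ n ih =>
    have bernoulli : 2 * (n + 1) ^ (n + 1) ≤ (n + 1 + 1) ^ (n + 1) := by
      have h := pow_add_mul_le_add_pow (a := n + 1) (b := 1) (by simp) (by simp) (n + 1)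
      simp only [Nat.add_sub_cancel, Nat.cast_id, mul_one] at h
      calc 2 * (n + 1) ^ (n + 1) = (n + 1) ^ (n + 1) + (n + 1) * (n + 1) ^ n := by ring
        _ ≤ (n + 1 + 1) ^ (n + 1) := by linarith
    calc (n + 1).factorial * 2 ^ (n + 1)
        = 2 * (n + 1) * (n.factorial * 2 ^ n) := by rw [Nat.factorial_succ]; ring
      _ ≤ 2 * (n + 1) * (n + 1) ^ n := by gcongr
      _ = 2 * (n + 1) ^ (n + 1) := by ring
      _ ≤ (n + 1 + 1) ^ (n + 1) := bernoulli

theorem factorial_le_pow_of_succ_le_two_mul {n m : ℕ} (h : n + 1 ≤ 2 * m) :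
    n.factorial ≤ m ^ n := by
  refine Nat.le_of_mul_le_mul_right ?_ (show 0 < 2 ^ n by positivity)
  calc n.factorial * 2 ^ n ≤ (n + 1) ^ n := factorial_mul_two_pow_le_succ_pow n
    _ ≤ (2 * m) ^ n := by gcongr
    _ = m ^ n * 2 ^ n := by rw [mul_pow, mul_comm]

theorem sum_vonMangoldt_mul_div_eq_log_factorial (N : ℕ) :
    ∑ n ∈ Finset.Icc 1 N, Λ n * (N / n : ℕ) = Real.log N.factorial := by
  have h := sum_Ioc_mul_zeta_eq_sum Λ N
  rw [vonMangoldt_mul_zeta] at h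
  change _ = ∑ n ∈ Finset.Icc 1 N, Λ n * (N / n : ℕ) at h
  rw [← h, ← Finset.prod_Ico_id_eq_factorial, Nat.cast_prod, Real.log_prod]
  · rfl
  · intro n hn
    have := (Finset.mem_Ico.mp hn).1
    positivity

/-- Since `N / n ≤ 2 ⌊N / n⌋` for `1 ≤ n ≤ N`, the sum of `Λ n / n` is controlled by `log N!`. -/
theorem mul_sum_vonMangoldt_div_le_two_mul_log_factorial (N : ℕ) :
    N * ∑ n ∈ Finset.Icc 1 N, Λ n / n ≤ 2 * Real.log N.factorial := by
  rw [← sum_vonMangoldt_mul_div_eq_log_factorial, Finset.mul_sum, Finset.mul_sum]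
  refine Finset.sum_le_sum fun n hn => ?_
  obtain ⟨hn1, hnN⟩ := Finset.mem_Icc.mp hn
  have hn0 : (0 : ℝ) < n := by exact_mod_cast hn1
  have hdiv : N ≤ 2 * (N / n) * n := by
    have hpos : 1 ≤ N / n := Nat.div_pos hnN hn1
    have hmod := Nat.div_add_mod N n
    have hlt := Nat.mod_lt N hn1
    nlinarith
  have hquot : (N : ℝ) / n ≤ 2 * (N / n : ℕ) := by
    rw [div_le_iff₀ hn0]
    exact_mod_cast hdiv
  calc (N : ℝ) * (Λ n / n) = Λ n * (N / n) := by ring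
    _ ≤ Λ n * (2 * (N / n : ℕ)) := mul_le_mul_of_nonneg_left hquot vonMangoldt_nonneg
    _ = 2 * (Λ n * (N / n : ℕ)) := by ring

theorem sum_vonMangoldt_div_le_of_factorial_le_pow {N m : ℕ} (h : N.factorial ≤ m ^ N) :
    ∑ n ∈ Finset.Icc 1 N, Λ n / n ≤ 2 * Real.log m := by
  rcases N.eq_zero_or_pos with rfl | hN
  · simpa using Real.log_natCast_nonneg m
  refine le_of_mul_le_mul_left ?_ (Nat.cast_pos.mpr hN : (0 : ℝ) < N)
  have hlog : Real.log N.factorial ≤ N * Real.log m := by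
    rw [← Real.log_pow]
    exact Real.log_le_log (by positivity) (by exact_mod_cast h)
  linarith [mul_sum_vonMangoldt_div_le_two_mul_log_factorial N]

/-- For every prime `p ≥ 3`, one has `∑_{n ≤ p + 2√p} Λ(n)/n ≤ 2 log p`, where the sum ranges
over all natural numbers `n` with `1 ≤ n ≤ p + 2√p`. -/
theorem vonMangoldt_div_sum_bound (p : ℕ) (hp : p.Prime) (hp3 : 3 ≤ p) :
    ∑ n ∈ Finset.Icc 1 ⌊(p : ℝ) + 2 * Real.sqrt p⌋₊, Λ n / n ≤ 2 * Real.log p := by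
  apply sum_vonMangoldt_div_le_of_factorial_le_pow
  have hsq := Real.sq_sqrt (Nat.cast_nonneg (α := ℝ) p)
  have hs0 := Real.sqrt_nonneg (p : ℝ)
  rcases hp3.eq_or_lt with rfl | hp4
  · have hfloor : ⌊((3 : ℕ) : ℝ) + 2 * Real.sqrt (3 : ℕ)⌋₊ = 6 := by
      rw [Nat.floor_eq_iff (by positivity)]
      push_cast at hsq hs0 ⊢
      constructor <;> nlinarith
    rw [hfloor]
    decide
  · have hp5 : 5 ≤ p := by
      rcases (Nat.succ_le_of_lt hp4).eq_or_lt with rfl | h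
      · norm_num at hp
      · exact h
    have hp5' : (5 : ℝ) ≤ p := by exact_mod_cast hp5
    apply factorial_le_pow_of_succ_le_two_mul
    rw [Nat.succ_le_iff, Nat.floor_lt (by positivity)]
    push_cast
    nlinarith
end
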